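/- arXiv:1405.1583 — 7 statements merged into one kernel-verified Lean document; each statement's English description precedes it below -/
import Mathlib

section
/- For every α ∈ (1,2], the mean of the α-offspring distribution equals α/(α−1); that is, Σ_{k=2}^∞ k·θ_α(k) = α/(α−1). -/
/-- The α-offspring distribution: θ_α(k) = α(2−α)(3−α)⋯(k−1−α)/k! for k ≥ 2, and 0 else. -/
noncomputable def thetaDist (α : ℝ) (k : ℕ) : ℝ :=
  if 2 ≤ k then α * (∏ i ∈ Finset.Icc 2 (k - 1), ((i : ℝ) - α)) / (Nat.factorial k : ℝ) else 0

open Filter Topology in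
/-- For `0 < c ≤ 1` the product `∏ (1 - c / (i + 1))` diverges to zero. -/
lemma tendsto_prod_one_sub_div_succ_zero {c : ℝ} (hc : 0 < c) (hc1 : c ≤ 1) :
    Tendsto (fun n : ℕ => ∏ i ∈ Finset.range n, (1 - c / ((i : ℝ) + 1))) atTop (𝓝 0) := by
  have nonneg (i : ℕ) : 0 ≤ 1 - c / ((i : ℝ) + 1) := by
    rw [sub_nonneg, div_le_one (by positivity)]
    have : (0 : ℝ) ≤ i := i.cast_nonneg
    linarith
  have exp_tendsto : Tendsto
      (fun n : ℕ => Real.exp (-(c * ∑ i ∈ Finset.range n, 1 / ((i : ℝ) + 1)))) atTop (𝓝 0) :=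
    Real.tendsto_exp_neg_atTop_nhds_zero.comp
      (Real.tendsto_sum_range_one_div_nat_succ_atTop.const_mul_atTop hc)
  refine squeeze_zero (fun n => Finset.prod_nonneg fun i _ => nonneg i) (fun n => ?_) exp_tendsto
  rw [Finset.mul_sum, ← Finset.sum_neg_distrib, Real.exp_sum]
  refine Finset.prod_le_prod (fun i _ => nonneg i) fun i _ => ?_
  have := Real.add_one_le_exp (-(c * (1 / ((i : ℝ) + 1))))
  calc 1 - c / ((i : ℝ) + 1) = -(c * (1 / ((i : ℝ) + 1))) + 1 := by ring
    _ ≤ _ := this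

lemma natCast_mul_thetaDist_add_two (α : ℝ) (n : ℕ) :
    ((n + 2 : ℕ) : ℝ) * thetaDist α (n + 2) =
      α / ((n : ℝ) + 1) * ∏ i ∈ Finset.range n, (1 - (α - 1) / ((i : ℝ) + 1)) := by
  have prod_eq : ∏ i ∈ Finset.Icc 2 (n + 1), ((i : ℝ) - α) =
      (n.factorial : ℝ) * ∏ i ∈ Finset.range n, (1 - (α - 1) / ((i : ℝ) + 1)) := by
    induction n with
    | zero => simp
    | succ n ih =>
      rw [Finset.prod_Icc_succ_top (by omega), ih, Finset.prod_range_succ, Nat.factorial_succ]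
      push_cast
      field_simp
      ring
  rw [thetaDist, if_pos (by omega), show n + 2 - 1 = n + 1 by omega, prod_eq,
    Nat.factorial_succ, Nat.factorial_succ]
  have := n.factorial_ne_zero
  push_cast
  field_simp
  ring

/-- The partial sums of the mean telescope. -/
lemma sum_range_natCast_mul_thetaDist_add_two {α : ℝ} (hα : α ≠ 1) (n : ℕ) :
    ∑ k ∈ Finset.range n, ((k + 2 : ℕ) : ℝ) * thetaDist α (k + 2) =
      α / (α - 1) * (1 - ∏ i ∈ Finset.range n, (1 - (α - 1) / ((i : ℝ) + 1))) := by
  have := sub_ne_zero.mpr hα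
  induction n with
  | zero => simp
  | succ n ih =>
    rw [Finset.sum_range_succ, ih, natCast_mul_thetaDist_add_two, Finset.prod_range_succ]
    field_simp
    ring

lemma thetaDist_nonneg {α : ℝ} (hα₀ : 0 ≤ α) (hα₂ : α ≤ 2) (k : ℕ) : 0 ≤ thetaDist α k := by
  unfold thetaDist
  split_ifs
  · refine div_nonneg (mul_nonneg hα₀ (Finset.prod_nonneg fun i hi => ?_)) (by positivity)
    have : (2 : ℝ) ≤ i := by exact_mod_cast (Finset.mem_Icc.mp hi).1
    linarith
  · exact le_rfl

/-- For every α ∈ (1,2], the mean of the α-offspring distribution equals α/(α−1). -/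
theorem mean_thetaDist (α : ℝ) (hα : α ∈ Set.Ioc (1 : ℝ) 2) :
    HasSum (fun k : ℕ => (k : ℝ) * thetaDist α k) (α / (α - 1)) := by
  obtain ⟨h1, h2⟩ := hα
  rw [← hasSum_nat_add_iff' 2, hasSum_iff_tendsto_nat_of_nonneg
    fun k => mul_nonneg (Nat.cast_nonneg _) (thetaDist_nonneg (by linarith) h2 _)]
  simp_rw [sum_range_natCast_mul_thetaDist_add_two h1.ne']
  have := ((tendsto_prod_one_sub_div_succ_zero (c := α - 1) (by linarith)
    (by linarith)).const_sub 1).const_mul (α / (α - 1))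
  simpa [Finset.sum_range_succ, thetaDist] using this
end

section
/- For every α ∈ (1,2), the sequence k^{1+α}·θ_α(k) converges to α/Γ(2−α) as k → ∞; in particular θ_α(k) = O(k^{−(1+α)}) as k → ∞. -/
open Filter Asymptotics

/-- The product defining `thetaDist` is the one in Euler's sequence `Real.GammaSeq` for `2 - α`,
up to its last three factors. -/
theorem prod_range_two_sub_add (α : ℝ) (k : ℕ) (hk : 2 ≤ k) :
    ∏ j ∈ Finset.range (k + 1), (2 - α + j) =
      (∏ i ∈ Finset.Icc 2 (k - 1), ((i : ℝ) - α)) *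
        ((k + (-α)) * (k + (1 - α)) * (k + (2 - α))) := by
  induction k, hk using Nat.le_induction with
  | base =>
    simp [Finset.prod_range_succ]
    ring
  | succ n hn ih =>
    have hIcc : Finset.Icc 2 (n + 1 - 1) = insert n (Finset.Icc 2 (n - 1)) := by
      ext i
      simp only [Finset.mem_Icc, Finset.mem_insert]
      omega
    rw [Finset.prod_range_succ, ih, hIcc, Finset.prod_insert (by simp; omega)]
    push_cast
    ring

theorem rpow_mul_thetaDist_eq {α : ℝ} (hα : α < 2) {k : ℕ} (hk : 2 ≤ k) :
    (k : ℝ) ^ (1 + α) * thetaDist α k =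
      α / Real.GammaSeq (2 - α) k *
        ((k : ℝ) / (k + (-α)) * (k / (k + (1 - α))) * (k / (k + (2 - α)))) := by
  have hk' : (2 : ℝ) ≤ k := by exact_mod_cast hk
  have hpow : (k : ℝ) ^ (1 + α) * (k : ℝ) ^ (2 - α) = (k : ℝ) ^ 3 := by
    rw [← Real.rpow_add (by linarith), ← Real.rpow_natCast]
    congr 1
    push_cast
    ring
  have hP : ∏ i ∈ Finset.Icc 2 (k - 1), ((i : ℝ) - α) ≠ 0 := by
    refine Finset.prod_ne_zero_iff.mpr fun i hi => ?_
    have : (2 : ℝ) ≤ i := by exact_mod_cast (Finset.mem_Icc.mp hi).1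
    linarith
  have h0 : (k : ℝ) + (-α) ≠ 0 := by linarith
  have h1 : (k : ℝ) + (1 - α) ≠ 0 := by linarith
  have h2 : (k : ℝ) + (2 - α) ≠ 0 := by linarith
  have hx : (k : ℝ) ^ (2 - α) ≠ 0 := (Real.rpow_pos_of_pos (by linarith) _).ne'
  have hf : (k.factorial : ℝ) ≠ 0 := by exact_mod_cast k.factorial_ne_zero
  rw [thetaDist, if_pos hk, Real.GammaSeq, prod_range_two_sub_add α k hk]
  generalize (∏ i ∈ Finset.Icc 2 (k - 1), ((i : ℝ) - α)) = P at *
  generalize (k : ℝ) ^ (2 - α) = x at *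
  generalize (k : ℝ) ^ (1 + α) = y at *
  generalize (k : ℝ) + (-α) = a at *
  generalize (k : ℝ) + (1 - α) = b at *
  generalize (k : ℝ) + (2 - α) = c at *
  field_simp
  linear_combination α * hpow

/-- For α ∈ (1,2), k^{1+α}·θ_α(k) → α/Γ(2−α) as k → ∞;
in particular θ_α(k) = O(k^{−(1+α)}). -/
theorem thetaDist_asymptotics (α : ℝ) (hα : α ∈ Set.Ioo (1 : ℝ) 2) :
    Tendsto (fun k : ℕ => (k : ℝ) ^ (1 + α) * thetaDist α k) atTop
      (nhds (α / Real.Gamma (2 - α))) ∧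
    (fun k : ℕ => thetaDist α k) =O[atTop] (fun k : ℕ => (k : ℝ) ^ (-(1 + α))) := by
  have hlim : Tendsto (fun k : ℕ => (k : ℝ) ^ (1 + α) * thetaDist α k) atTop
      (nhds (α / Real.Gamma (2 - α))) := by
    have hΓ : Real.Gamma (2 - α) ≠ 0 := (Real.Gamma_pos_of_pos (by linarith [hα.2])).ne'
    have h := ((tendsto_const_nhds (x := α)).div (Real.GammaSeq_tendsto_Gamma (2 - α)) hΓ).mul
      (((tendsto_natCast_div_add_atTop (-α)).mul
        (tendsto_natCast_div_add_atTop (1 - α))).mul (tendsto_natCast_div_add_atTop (2 - α)))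
    simp only [mul_one] at h
    refine h.congr' ?_
    filter_upwards [eventually_ge_atTop 2] with k hk
    exact (rpow_mul_thetaDist_eq hα.2 hk).symm
  refine ⟨hlim, ?_⟩
  have h := (isBigO_refl (fun k : ℕ => (k : ℝ) ^ (-(1 + α))) atTop).mul (hlim.isBigO_one ℝ)
  simp only [mul_one] at h
  refine h.congr' ?_ EventuallyEq.rfl
  filter_upwards [eventually_gt_atTop 0] with k hk
  have hk' : (0 : ℝ) < k := by exact_mod_cast hk
  rw [← mul_assoc, ← Real.rpow_add hk', neg_add_cancel, Real.rpow_zero, one_mul]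
end

section
/- Let n ≥ 2 be an integer, let u ∈ [0,1], and let x₁,…,x_n and y₁,…,y_n all lie in [1,∞). Then |G(u,n,(x_i)) − G(u,n,(y_i))| ≤ (Σ_{i=1}^n |x_i − y_i|) · (1−u)/(1+(n−1)u)². -/
/-- G(u,n,(x_i)) = (u + (1−u)/(x₁+⋯+x_n))⁻¹. -/
noncomputable def Gfun {n : ℕ} (u : ℝ) (x : Fin n → ℝ) : ℝ :=
  (u + (1 - u) / ∑ i, x i)⁻¹

/-- Closed form of `Gfun` when the sum of the entries is positive. -/
theorem Gfun_eq_div {n : ℕ} (u : ℝ) (x : Fin n → ℝ) (hx : 0 < ∑ i, x i) :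
    Gfun u x = (∑ i, x i) / (1 + ((∑ i, x i) - 1) * u) := by
  have h : u + (1 - u) / ∑ i, x i = (1 + ((∑ i, x i) - 1) * u) / ∑ i, x i := by
    field_simp
    ring
  rw [Gfun, h, inv_div]

/-- The map `s ↦ s / (1 + (s - 1) * u)` is Lipschitz on `[m, ∞)`, with constant its derivative
at `m`. -/
theorem abs_div_sub_div_le {u m s t : ℝ} (hu : u ∈ Set.Icc (0 : ℝ) 1) (hm : 1 ≤ m)
    (hs : m ≤ s) (ht : m ≤ t) :
    |s / (1 + (s - 1) * u) - t / (1 + (t - 1) * u)| ≤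
      |s - t| * (1 - u) / (1 + (m - 1) * u) ^ 2 := by
  obtain ⟨hu0, hu1⟩ := hu
  have hm0 : 0 < 1 + (m - 1) * u := by nlinarith
  have hms : 1 + (m - 1) * u ≤ 1 + (s - 1) * u := by gcongr
  have hmt : 1 + (m - 1) * u ≤ 1 + (t - 1) * u := by gcongr
  have hs0 := hm0.trans_le hms
  have ht0 := hm0.trans_le hmt
  have h : s / (1 + (s - 1) * u) - t / (1 + (t - 1) * u) =
      (s - t) * (1 - u) / ((1 + (s - 1) * u) * (1 + (t - 1) * u)) := by
    rw [div_sub_div _ _ hs0.ne' ht0.ne']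
    ring
  have h1u : 0 ≤ 1 - u := by linarith
  rw [h, abs_div, abs_mul, abs_of_nonneg h1u, abs_of_pos (mul_pos hs0 ht0), sq]
  gcongr

/-- The Lipschitz-type bound:
|G(u,n,(x_i)) − G(u,n,(y_i))| ≤ (Σ |x_i − y_i|)·(1−u)/(1+(n−1)u)². -/
theorem Gfun_contraction (n : ℕ) (hn : 2 ≤ n) (u : ℝ) (hu : u ∈ Set.Icc (0 : ℝ) 1)
    (x y : Fin n → ℝ) (hx : ∀ i, 1 ≤ x i) (hy : ∀ i, 1 ≤ y i) :
    |Gfun u x - Gfun u y| ≤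
      (∑ i, |x i - y i|) * (1 - u) / (1 + ((n : ℝ) - 1) * u) ^ 2 := by
  have sum_ge : ∀ z : Fin n → ℝ, (∀ i, 1 ≤ z i) → (n : ℝ) ≤ ∑ i, z i := fun z hz => by
    simpa using Finset.sum_le_sum fun i (_ : i ∈ Finset.univ) => hz i
  have hn1 : (1 : ℝ) ≤ n := by exact_mod_cast (by lia : 1 ≤ n)
  have hxs := sum_ge x hx
  have hys := sum_ge y hy
  have h1u : 0 ≤ 1 - u := by linarith [hu.2]
  rw [Gfun_eq_div u x (by linarith), Gfun_eq_div u y (by linarith)]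
  refine (abs_div_sub_div_le hu hn1 hxs hys).trans ?_
  gcongr
  rw [← Finset.sum_sub_distrib]
  exact Finset.abs_sum_le_sum_abs _ _
end

section
/- For every integer k ≥ 2, ∫_{[0,1]^k} log(u₁^{−1} + u₂^{−1} + ⋯ + u_k^{−1}) du₁⋯du_k ≤ (2 + k/(k−1))·log k. -/
open MeasureTheory

/-- For nonnegative reals and `0 < p ≤ 1`, the `p`-th power of a sum is at most the sum of the
`p`-th powers. -/
lemma Real.rpow_sum_le_sum_rpow_of_le_one {ι : Type*} (s : Finset ι) {x : ι → ℝ} {p : ℝ}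
    (hp : 0 < p) (hp1 : p ≤ 1) (hx : ∀ i ∈ s, 0 ≤ x i) :
    (∑ i ∈ s, x i) ^ p ≤ ∑ i ∈ s, x i ^ p :=
  Finset.le_sum_of_subadditive_on_pred (fun y : ℝ => y ^ p) (fun y => 0 ≤ y)
    (by simp [Real.zero_rpow hp.ne'])
    (fun _ _ ha hb => Real.rpow_add_le_add_rpow ha hb hp.le hp1)
    (fun _ _ => add_nonneg) x hx

/-- The tangent line of `log` at `c` bounds `log` of a sum through the sum of `p`-th powers. -/
lemma Real.log_sum_le_of_rpow {ι : Type*} (s : Finset ι) {x : ι → ℝ} {p c : ℝ}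
    (hp : 0 < p) (hp1 : p ≤ 1) (hc : 0 < c) (hx : ∀ i ∈ s, 0 ≤ x i) (hs : 0 < ∑ i ∈ s, x i) :
    Real.log (∑ i ∈ s, x i) ≤ p⁻¹ * (Real.log c - 1 + c⁻¹ * ∑ i ∈ s, x i ^ p) := by
  have hle := Real.rpow_sum_le_sum_rpow_of_le_one s hp hp1 hx
  have hpow : 0 < (∑ i ∈ s, x i) ^ p := Real.rpow_pos_of_pos hs p
  have hS : 0 < ∑ i ∈ s, x i ^ p := hpow.trans_le hle
  have hlog : p * Real.log (∑ i ∈ s, x i) ≤ Real.log (∑ i ∈ s, x i ^ p) := by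
    rw [← Real.log_rpow hs]
    exact Real.log_le_log hpow hle
  have htangent := Real.log_le_sub_one_of_pos (mul_pos (inv_pos.mpr hc) hS)
  rw [Real.log_mul (inv_ne_zero hc.ne') hS.ne', Real.log_inv] at htangent
  rw [← div_eq_inv_mul, le_div_iff₀ hp]
  linarith

/-- The function `x⁻¹ ^ p` is integrable on the unit interval for `p < 1`. -/
lemma integrable_inv_rpow_restrict_Icc {p : ℝ} (hp : p < 1) :
    Integrable (fun x : ℝ => x⁻¹ ^ p) (volume.restrict (Set.Icc 0 1)) := by
  have h : IntegrableOn (fun x : ℝ => x ^ (-p)) (Set.Icc 0 1) :=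
    (intervalIntegrable_iff_integrableOn_Icc_of_le zero_le_one).mp
      (intervalIntegral.intervalIntegrable_rpow' (by linarith))
  exact h.congr_fun (fun x hx => by simp only [Real.rpow_neg hx.1, Real.inv_rpow hx.1])
    measurableSet_Icc

lemma integral_inv_rpow_restrict_Icc {p : ℝ} (hp : p < 1) :
    ∫ x in Set.Icc (0 : ℝ) 1, x⁻¹ ^ p = (1 - p)⁻¹ := by
  have h : ∫ x in Set.Icc (0 : ℝ) 1, x⁻¹ ^ p = ∫ x in Set.Icc (0 : ℝ) 1, x ^ (-p) :=
    setIntegral_congr_fun measurableSet_Icc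
      (fun x hx => by simp only [Real.rpow_neg hx.1, Real.inv_rpow hx.1])
  rw [h, integral_Icc_eq_integral_Ioc, ← intervalIntegral.integral_of_le zero_le_one,
    integral_rpow (Or.inl (by linarith)), Real.one_rpow, Real.zero_rpow (by linarith), sub_zero,
    one_div, neg_add_eq_sub]

/-- For every integer k ≥ 2,
∫_{[0,1]^k} log(u₁⁻¹ + ⋯ + u_k⁻¹) du ≤ (2 + k/(k−1))·log k. -/
theorem integral_log_sum_inv_le (k : ℕ) (hk : 2 ≤ k) :
    (∫ u : Fin k → ℝ, Real.log (∑ i, (u i)⁻¹)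
        ∂(Measure.pi fun _ : Fin k => volume.restrict (Set.Icc (0 : ℝ) 1)))
      ≤ (2 + (k : ℝ) / ((k : ℝ) - 1)) * Real.log k := by
  have hk' : (2 : ℝ) ≤ k := by exact_mod_cast hk
  have hk0 : (0 : ℝ) < k := by linarith
  have hk1 : (0 : ℝ) < k - 1 := by linarith
  have : IsProbabilityMeasure (volume.restrict (Set.Icc (0 : ℝ) 1)) := ⟨by simp⟩
  set μ : Measure (Fin k → ℝ) := Measure.pi fun _ => volume.restrict (Set.Icc (0 : ℝ) 1)
  set p : ℝ := 1 - (k : ℝ)⁻¹ with hp_def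
  have hp1 : p < 1 := by have := inv_pos.mpr hk0; linarith
  have hp : 0 < p := sub_pos.mpr (inv_lt_one_of_one_lt₀ (by linarith))
  have hmp (i : Fin k) : MeasurePreserving (fun u : Fin k → ℝ => u i) μ
      (volume.restrict (Set.Icc (0 : ℝ) 1)) :=
    measurePreserving_eval (fun _ : Fin k => volume.restrict (Set.Icc (0 : ℝ) 1)) i
  have hint (i : Fin k) : Integrable (fun u : Fin k → ℝ => (u i)⁻¹ ^ p) μ :=
    (hmp i).integrable_comp_of_integrable (integrable_inv_rpow_restrict_Icc hp1)
  have hval (i : Fin k) : ∫ u : Fin k → ℝ, (u i)⁻¹ ^ p ∂μ = k := by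
    have h := integral_map (hmp i).measurable.aemeasurable (f := fun x : ℝ => x⁻¹ ^ p)
      (by rw [(hmp i).map_eq]; exact (integrable_inv_rpow_restrict_Icc hp1).1)
    rw [← h, (hmp i).map_eq, integral_inv_rpow_restrict_Icc hp1, hp_def, sub_sub_cancel, inv_inv]
  have hsum : Integrable (fun u : Fin k → ℝ => ∑ i, (u i)⁻¹ ^ p) μ :=
    integrable_finsetSum _ fun i _ => hint i
  have hmem : ∀ᵐ u ∂μ, ∀ i, u i ∈ Set.Ioc (0 : ℝ) 1 := by
    refine ae_all_iff.mpr fun i => (hmp i).quasiMeasurePreserving.ae ?_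
    rw [← Measure.restrict_congr_set Ioc_ae_eq_Icc]
    exact ae_restrict_mem measurableSet_Ioc
  have hone : ∀ u : Fin k → ℝ, (∀ i, u i ∈ Set.Ioc (0 : ℝ) 1) → 1 ≤ ∑ i, (u i)⁻¹ := fun u hu =>
    (one_le_inv₀ (hu ⟨0, by omega⟩).1).mpr (hu _).2 |>.trans <|
      Finset.single_le_sum (f := fun i => (u i)⁻¹) (fun i _ => inv_nonneg.mpr (hu i).1.le)
        (Finset.mem_univ _)
  calc
    _ ≤ ∫ u, p⁻¹ * (Real.log ((k : ℝ) ^ 2) - 1 + ((k : ℝ) ^ 2)⁻¹ * ∑ i, (u i)⁻¹ ^ p) ∂μ := by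
      refine integral_mono_of_nonneg ?_
        (((integrable_const _).add (hsum.const_mul _)).const_mul _) ?_
      · filter_upwards [hmem] with u hu using Real.log_nonneg (hone u hu)
      · filter_upwards [hmem] with u hu
        exact Real.log_sum_le_of_rpow _ hp hp1.le (by positivity)
          (fun i _ => inv_nonneg.mpr (hu i).1.le) (zero_lt_one.trans_le (hone u hu))
    _ = p⁻¹ * Real.log ((k : ℝ) ^ 2) := by
      rw [integral_const_mul, integral_add (integrable_const _) (hsum.const_mul _),
        integral_const_mul, integral_finsetSum _ fun i _ => hint i]
      simp only [hval, integral_const, probReal_univ, one_smul, Finset.sum_const,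
        Finset.card_univ, Fintype.card_fin, nsmul_eq_mul]
      field_simp
      ring
    _ ≤ (2 + (k : ℝ) / ((k : ℝ) - 1)) * Real.log k := by
      have hpinv : p⁻¹ = k / (k - 1) := by
        rw [hp_def]
        field_simp
      have hratio : (k : ℝ) / (k - 1) ≤ 2 := (div_le_iff₀ hk1).mpr (by linarith)
      have hlog : 0 ≤ Real.log k := Real.log_nonneg (by linarith)
      rw [Real.log_pow, hpinv]
      push_cast
      nlinarith
end

section
/- Let α ∈ (1,2] and let γ be a probability measure on [1,∞) that is a fixed point of the α-recursive distributional equation. Then γ is absolutely continuous with respect to Lebesgue measure and admits a continuous density on [1,∞): there exists a continuous function f : [1,∞) → [0,∞) such that γ(A) = ∫_A f(t) dt for every Borel set A ⊆ [1,∞). -/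
open MeasureTheory

/-- The uniform distribution on [0,1]. -/
noncomputable def unifMeasure : Measure ℝ := volume.restrict (Set.Icc 0 1)

/-- The map on measures associated with the α-recursive distributional equation:
the law of G(U,N,(X₁,…,X_N)) = (U + (1−U)/(X₁+⋯+X_N))⁻¹ where U is uniform on [0,1],
N ~ θ_α and the X_i are i.i.d. with law γ, all independent (decomposed according to
the value of N). -/
noncomputable def rdeMap (α : ℝ) (γ : Measure ℝ) : Measure ℝ :=
  Measure.sum fun k : ℕ =>
    ENNReal.ofReal (thetaDist α k) •
      Measure.map (fun p : ℝ × (Fin k → ℝ) => (p.1 + (1 - p.1) / ∑ i, p.2 i)⁻¹)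
        (unifMeasure.prod (Measure.pi fun _ : Fin k => γ))

/-- γ is a probability measure on [1,∞) that is a fixed point of the α-recursive
distributional equation. -/
def IsRDEFixedPoint (α : ℝ) (γ : Measure ℝ) : Prop :=
  IsProbabilityMeasure γ ∧ γ (Set.Iio 1) = 0 ∧ rdeMap α γ = γ

/-- The law of `X₁ + ⋯ + X_N`, where `N ~ θ_α` and the `X_i` are i.i.d. with law `γ`. -/
noncomputable def sumLaw (α : ℝ) (γ : Measure ℝ) : Measure ℝ :=
  Measure.sum fun k : ℕ =>
    ENNReal.ofReal (thetaDist α k) •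
      Measure.map (fun x : Fin k → ℝ => ∑ i, x i) (Measure.pi fun _ : Fin k => γ)

theorem sumLaw_eq_zero {α : ℝ} {γ : Measure ℝ} {A : Set ℝ} (hA : MeasurableSet A)
    (h : ∀ k, 2 ≤ k → (Measure.pi fun _ : Fin k => γ) {x | ∑ i, x i ∈ A} = 0) :
    sumLaw α γ A = 0 := by
  rw [sumLaw, Measure.sum_apply _ hA, ENNReal.tsum_eq_zero]
  intro k
  rw [Measure.smul_apply, smul_eq_mul, Measure.map_apply (by fun_prop) hA]
  by_cases hk : 2 ≤ k
  · exact mul_eq_zero_of_right _ (h k hk)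
  · simp [thetaDist, hk]

theorem rdeMap_apply (α : ℝ) (γ : Measure ℝ) [IsProbabilityMeasure γ] {A : Set ℝ}
    (hA : MeasurableSet A) :
    rdeMap α γ A = ∫⁻ s, unifMeasure {u | (u + (1 - u) / s)⁻¹ ∈ A} ∂(sumLaw α γ) := by
  have : SFinite unifMeasure := by unfold unifMeasure; infer_instance
  have hm : MeasurableSet {p : ℝ × ℝ | (p.2 + (1 - p.2) / p.1)⁻¹ ∈ A} :=
    (by fun_prop : Measurable fun p : ℝ × ℝ => (p.2 + (1 - p.2) / p.1)⁻¹) hA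
  have hu : Measurable fun s : ℝ => unifMeasure {u | (u + (1 - u) / s)⁻¹ ∈ A} :=
    measurable_measure_prodMk_left hm
  rw [rdeMap, sumLaw, Measure.sum_apply _ hA, lintegral_sum_measure]
  refine tsum_congr fun k => ?_
  have hG : Measurable fun p : ℝ × (Fin k → ℝ) => (p.1 + (1 - p.1) / ∑ i, p.2 i)⁻¹ := by
    fun_prop
  rw [Measure.smul_apply, lintegral_smul_measure, lintegral_map hu (by fun_prop),
    Measure.map_apply hG hA, Measure.prod_apply_symm (hG hA)]
  rfl

theorem sumLaw_univ (α : ℝ) (γ : Measure ℝ) [IsProbabilityMeasure γ] :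
    sumLaw α γ Set.univ = rdeMap α γ Set.univ := by
  rw [rdeMap_apply α γ MeasurableSet.univ]
  simp [unifMeasure]

/-- Conditionally on the sum being `s`, the law of `G` has density `s / (s - 1) / t ^ 2` on
`[1, s]`. -/
theorem unifMeasure_setOf_inv_mem {s : ℝ} (hs : 1 < s) {A : Set ℝ} (hA : MeasurableSet A)
    (hA1 : A ⊆ Set.Ici 1) :
    unifMeasure {u | (u + (1 - u) / s)⁻¹ ∈ A} =
      ∫⁻ t in A, ENNReal.ofReal ((t ^ 2)⁻¹ * (Set.Ici t).indicator (fun s => s / (s - 1)) s) := by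
  have hs0 : 0 < s := by linarith
  have hs1 : 0 < s - 1 := by linarith
  set φ : ℝ → ℝ := fun t => (s / (s - 1)) * (t⁻¹ - s⁻¹) with hφ
  have hmem : ∀ t ∈ A ∩ Set.Iic s, 0 < t := fun t ht => lt_of_lt_of_le one_pos (hA1 ht.1)
  have hinv : ∀ t, 0 < t → (φ t + (1 - φ t) / s)⁻¹ = t := by
    intro t ht
    rw [inv_eq_iff_eq_inv, hφ]
    field_simp
    ring
  have himage : {u | (u + (1 - u) / s)⁻¹ ∈ A} ∩ Set.Icc 0 1 = φ '' (A ∩ Set.Iic s) := by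
    ext u
    constructor
    · rintro ⟨hu, hu0, hu1⟩
      have hd : 0 < u + (1 - u) / s := by
        have : u + (1 - u) / s = (u * (s - 1) + 1) / s := by field_simp; ring
        rw [this]
        positivity
      refine ⟨_, ⟨hu, ?_⟩, ?_⟩
      · rw [Set.mem_Iic, inv_le_comm₀ hd hs0, inv_eq_one_div, ← sub_nonneg]
        have : u + (1 - u) / s - 1 / s = u * (s - 1) / s := by field_simp; ring
        rw [this]
        positivity
      · simp only [hφ, inv_inv]
        field_simp
        ring
    · rintro ⟨t, ht, rfl⟩
      have ht0 := hmem t ht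
      have ht1 : 1 ≤ t := hA1 ht.1
      have hts : t ≤ s := ht.2
      refine ⟨?_, ?_, ?_⟩
      · rw [Set.mem_ofPred_eq, hinv t ht0]
        exact ht.1
      · exact mul_nonneg (by positivity) (sub_nonneg.2 (inv_anti₀ ht0 hts))
      · have : φ t = (s - t) / (t * (s - 1)) := by simp only [hφ]; field_simp
        rw [this, div_le_one (by positivity)]
        nlinarith
  have hinj : Set.InjOn φ (A ∩ Set.Iic s) := by
    intro t ht t' ht' h
    rw [← hinv t (hmem t ht), h, hinv t' (hmem t' ht')]
  have hderiv : ∀ t ∈ A ∩ Set.Iic s, HasDerivWithinAt φ ((s / (s - 1)) * (-(t ^ 2)⁻¹))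
      (A ∩ Set.Iic s) t := fun t ht =>
    (((hasDerivAt_inv (hmem t ht).ne').sub_const _).const_mul _).hasDerivWithinAt
  have hset : MeasurableSet {u | (u + (1 - u) / s)⁻¹ ∈ A} :=
    (by fun_prop : Measurable fun u : ℝ => (u + (1 - u) / s)⁻¹) hA
  have hcov := lintegral_image_eq_lintegral_abs_deriv_mul (hA.inter measurableSet_Iic) hderiv hinj
    (fun _ => 1)
  simp only [lintegral_one, Measure.restrict_apply_univ, mul_one] at hcov
  rw [unifMeasure, Measure.restrict_apply hset, himage, hcov, Set.inter_comm,
    ← Measure.restrict_restrict measurableSet_Iic, ← lintegral_indicator measurableSet_Iic]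
  refine lintegral_congr fun t => ?_
  by_cases hts : t ≤ s
  · rw [Set.indicator_of_mem (Set.mem_Iic.2 hts), Set.indicator_of_mem (Set.mem_Ici.2 hts),
      abs_mul, abs_neg, abs_of_pos (div_pos hs0 hs1), abs_of_nonneg (by positivity), mul_comm]
  · rw [Set.indicator_of_notMem (by simpa using hts), Set.indicator_of_notMem (by simpa using hts)]
    simp

theorem ae_two_le_sumLaw {α : ℝ} {γ : Measure ℝ} [IsProbabilityMeasure γ]
    (h1 : γ (Set.Iio 1) = 0) : ∀ᵐ s ∂(sumLaw α γ), 2 ≤ s := by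
  have : {s : ℝ | ¬ 2 ≤ s} = Set.Iio 2 := by ext; simp
  rw [ae_iff, this]
  refine sumLaw_eq_zero measurableSet_Iio fun k hk => ?_
  have hae : ∀ᵐ x ∂(Measure.pi fun _ : Fin k => γ), ∀ i, 1 ≤ x i := by
    rw [ae_all_iff]
    intro i
    have hγ : ∀ᵐ x ∂γ, 1 ≤ x := by
      rw [ae_iff]
      simpa [← Set.Iio_def] using h1
    exact (measurePreserving_eval (fun _ : Fin k => γ) i).quasiMeasurePreserving.ae hγ
  have h2 : ∀ᵐ x ∂(Measure.pi fun _ : Fin k => γ), ¬ ∑ i, x i ∈ Set.Iio (2 : ℝ) := by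
    filter_upwards [hae] with x hx
    have hsum : ∑ _i : Fin k, (1 : ℝ) ≤ ∑ i, x i := Finset.sum_le_sum fun i _ => hx i
    have hk' : (2 : ℝ) ≤ k := by exact_mod_cast hk
    simp only [Finset.sum_const, Finset.card_univ, Fintype.card_fin, nsmul_eq_mul, mul_one] at hsum
    simpa using hk'.trans hsum
  simpa [ae_iff] using h2

theorem pi_setOf_sum_eq (γ : Measure ℝ) [SigmaFinite γ] [NullSingletonClass γ] (n : ℕ) (t : ℝ) :
    (Measure.pi fun _ : Fin (n + 1) => γ) {x | ∑ i, x i = t} = 0 := by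
  have hB : MeasurableSet {p : ℝ × (Fin n → ℝ) | p.1 + ∑ i, p.2 i = t} :=
    measurableSet_eq_fun (by fun_prop) (by fun_prop)
  have hmp := measurePreserving_piFinSuccAbove (fun _ : Fin (n + 1) => γ) 0
  have hpre : {x : Fin (n + 1) → ℝ | ∑ i, x i = t} =
      (MeasurableEquiv.piFinSuccAbove (fun _ : Fin (n + 1) => ℝ) 0) ⁻¹'
        {p : ℝ × (Fin n → ℝ) | p.1 + ∑ i, p.2 i = t} := by
    ext x
    simp [Fin.sum_univ_succ, MeasurableEquiv.piFinSuccAbove, Fin.tail, Fin.insertNthEquiv]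
  rw [hpre, hmp.measure_preimage hB.nullMeasurableSet, Measure.prod_apply_symm hB,
    lintegral_eq_zero_iff (measurable_measure_prodMk_right hB)]
  refine Filter.Eventually.of_forall fun y => ?_
  have : (fun x : ℝ => (x, y)) ⁻¹' {p : ℝ × (Fin n → ℝ) | p.1 + ∑ i, p.2 i = t} =
      {t - ∑ i, y i} := by
    ext x
    simp [eq_sub_iff_add_eq]
  simp only [this, measure_singleton, Pi.zero_apply]

theorem sumLaw_singleton (α : ℝ) (γ : Measure ℝ) [SigmaFinite γ] [NullSingletonClass γ] (t : ℝ) :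
    sumLaw α γ {t} = 0 := by
  refine sumLaw_eq_zero (measurableSet_singleton t) fun k hk => ?_
  obtain ⟨n, rfl⟩ : ∃ n, k = n + 1 := ⟨k - 1, by omega⟩
  exact pi_setOf_sum_eq γ n t

/-- A fixed point γ of the α-RDE has a continuous density with respect to Lebesgue
measure on [1,∞). -/
theorem continuous_density (α : ℝ) (hα : α ∈ Set.Ioc (1 : ℝ) 2)
    (γ : Measure ℝ) (hγ : IsRDEFixedPoint α γ) :
    ∃ f : ℝ → ℝ, ContinuousOn f (Set.Ici 1) ∧ (∀ t ∈ Set.Ici (1 : ℝ), 0 ≤ f t) ∧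
      ∀ A : Set ℝ, MeasurableSet A → A ⊆ Set.Ici 1 →
        γ A = ENNReal.ofReal (∫ t in A, f t) := by
  obtain ⟨hprob, h1, hfix⟩ := hγ
  set σ := sumLaw α γ with hσ
  have : IsFiniteMeasure σ := ⟨by rw [hσ, sumLaw_univ, hfix]; exact measure_lt_top _ _⟩
  have h2 : ∀ᵐ s ∂σ, 2 ≤ s := ae_two_le_sumLaw h1
  set w : ℝ → ℝ → ℝ := fun t => (Set.Ici t).indicator (fun s => s / (s - 1)) with hw
  have hw_meas : Measurable (Function.uncurry w) := by
    have : Function.uncurry w =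
        {p : ℝ × ℝ | p.1 ≤ p.2}.indicator (fun p => p.2 / (p.2 - 1)) := by
      ext p
      simp [hw, Function.uncurry, Set.indicator]
    rw [this]
    exact (by fun_prop : Measurable fun p : ℝ × ℝ => p.2 / (p.2 - 1)).indicator
      (measurableSet_le measurable_fst measurable_snd)
  have hw_meas' : ∀ t, Measurable (w t) := fun t => hw_meas.comp measurable_prodMk_left
  have hw_nonneg : ∀ t s, 2 ≤ s → 0 ≤ w t s := fun t s hs =>
    Set.indicator_apply_nonneg fun _ => div_nonneg (by linarith) (by linarith)
  have hw_le : ∀ t s, 2 ≤ s → w t s ≤ 2 := fun t s hs =>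
    Set.indicator_apply_le' (fun _ => by rw [div_le_iff₀ (by linarith)]; linarith)
      fun _ => zero_le_two
  have hw_bound : ∀ t, ∀ᵐ s ∂σ, ‖w t s‖ ≤ 2 := fun t => by
    filter_upwards [h2] with s hs
    rw [Real.norm_of_nonneg (hw_nonneg t s hs)]
    exact hw_le t s hs
  have hw_int : ∀ t, Integrable (w t) σ := fun t =>
    Integrable.of_bound (hw_meas' t).aestronglyMeasurable 2 (hw_bound t)
  set f : ℝ → ℝ := fun t => (t ^ 2)⁻¹ * ∫ s, w t s ∂σ with hf
  have hf_nonneg : ∀ t, 0 ≤ f t := fun t =>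
    mul_nonneg (by positivity) (integral_nonneg_of_ae (h2.mono (hw_nonneg t)))
  have hdensity : ∀ A, MeasurableSet A → A ⊆ Set.Ici 1 →
      γ A = ∫⁻ t in A, ENNReal.ofReal (f t) := by
    intro A hA hA1
    calc γ A = ∫⁻ s, (∫⁻ t in A, ENNReal.ofReal ((t ^ 2)⁻¹ * w t s)) ∂σ := by
          rw [← hfix, rdeMap_apply α γ hA]
          refine lintegral_congr_ae (h2.mono fun s hs => ?_)
          exact unifMeasure_setOf_inv_mem (by linarith) hA hA1
      _ = ∫⁻ t in A, ∫⁻ s, ENNReal.ofReal ((t ^ 2)⁻¹ * w t s) ∂σ := by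
          refine lintegral_lintegral_swap (Measurable.aemeasurable ?_)
          exact ((by fun_prop : Measurable fun p : ℝ × ℝ => (p.2 ^ 2)⁻¹).mul
            (hw_meas.comp measurable_swap)).ennreal_ofReal
      _ = ∫⁻ t in A, ENNReal.ofReal (f t) := by
          refine lintegral_congr fun t => ?_
          simp only [hf]
          rw [← integral_const_mul, ofReal_integral_eq_lintegral_ofReal
            ((hw_int t).const_mul _)]
          exact h2.mono fun s hs => mul_nonneg (by positivity) (hw_nonneg t s hs)
  have : NullSingletonClass γ := by
    refine ⟨fun x => ?_⟩
    rcases lt_or_ge x 1 with hx | hx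
    · exact measure_mono_null (Set.singleton_subset_iff.2 hx) h1
    · rw [hdensity {x} (measurableSet_singleton x) (Set.singleton_subset_iff.2 hx)]
      simp
  have hf_cont : ContinuousOn f (Set.Ici 1) := by
    intro t₀ ht₀
    have ht₀' : t₀ ^ 2 ≠ 0 := pow_ne_zero _ (lt_of_lt_of_le one_pos ht₀).ne'
    refine ContinuousAt.continuousWithinAt (ContinuousAt.mul
      ((continuous_pow 2).continuousAt.inv₀ ht₀') ?_)
    refine continuousAt_of_dominated (bound := fun _ => 2)
      (.of_forall fun t => (hw_meas' t).aestronglyMeasurable) (.of_forall hw_bound)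
      (integrable_const _) ?_
    have hne : ∀ᵐ s ∂σ, s ≠ t₀ := by
      rw [ae_iff]
      simpa using sumLaw_singleton α γ t₀
    filter_upwards [hne] with s hs
    have hloc : (fun t => w t s) =ᶠ[nhds t₀] fun _ => w t₀ s := by
      rcases lt_or_gt_of_ne hs with h | h
      · filter_upwards [lt_mem_nhds h] with t ht
        simp [hw, not_le.2 ht, not_le.2 h]
      · filter_upwards [gt_mem_nhds h] with t ht
        simp [hw, ht.le, h.le]
    exact continuousAt_const.congr hloc.symm
  refine ⟨f, hf_cont, fun t _ => hf_nonneg t, fun A hA hA1 => ?_⟩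
  have hint : Integrable f (volume.restrict A) := by
    refine ⟨(hf_cont.mono hA1).aestronglyMeasurable hA, ?_⟩
    rw [hasFiniteIntegral_iff_ofReal (.of_forall hf_nonneg), ← hdensity A hA hA1]
    exact measure_lt_top _ _
  rw [hdensity A hA hA1, ofReal_integral_eq_lintegral_ofReal hint (.of_forall hf_nonneg)]
end

section
/- Let α ∈ (1,2] and let γ be a probability measure on [1,∞) that is a fixed point of the α-recursive distributional equation. Then for every nondecreasing continuously differentiable function g : [1,∞) → [0,∞), the identity ∫ s(s−1)·g′(s) γ(ds) + ∫ g(s) γ(ds) = Σ_{k=2}^∞ θ_α(k) · ∫_{[1,∞)^k} g(s₁+⋯+s_k) γ^{⊗k}(ds₁⋯ds_k) holds as an equality of extended nonnegative reals. -/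
open MeasureTheory

open Set

/-- For `u ∈ [0,1]` and `S ≥ 1`, the map `G` takes values in `[1,∞)`. -/
lemma one_le_inv_convexComb {S u : ℝ} (hS : 1 ≤ S) (hu : u ∈ Icc (0 : ℝ) 1) :
    0 < u + (1 - u) / S ∧ 1 ≤ (u + (1 - u) / S)⁻¹ := by
  have hS0 : 0 < S := by linarith
  have hpos : 0 < u + (1 - u) / S := by
    have h : u + (1 - u) / S = (u * (S - 1) + 1) / S := by field_simp; ring
    rw [h]
    have := mul_nonneg hu.1 (sub_nonneg.2 hS)
    positivity
  refine ⟨hpos, (one_le_inv₀ hpos).2 ?_⟩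
  have := div_le_self (sub_nonneg.2 hu.2) hS
  linarith

lemma hasDerivAt_inv_convexComb {S u : ℝ} (h : u + (1 - u) / S ≠ 0) :
    HasDerivAt (fun v : ℝ => (v + (1 - v) / S)⁻¹)
      (-(1 - 1 / S) / (u + (1 - u) / S) ^ 2) u := by
  have hd : HasDerivAt (fun v : ℝ => v + (1 - v) / S) (1 - 1 / S) u := by
    refine ((hasDerivAt_id' u).add (((hasDerivAt_id' u).const_sub 1).div_const S)).congr_deriv ?_
    ring
  exact hd.inv h

/-- Averaging `s(s-1)g′(s) + g(s)` over `s = G(u, S)`, with `u` uniform, gives `g(S)`. -/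
lemma integral_unif_inv_convexComb {g : ℝ → ℝ} (hg : ContDiffOn ℝ 1 g (Ici 1))
    {S : ℝ} (hS : 1 ≤ S) :
    let h : ℝ → ℝ := fun s => s * (s - 1) * derivWithin g (Ici 1) s + g s
    ContinuousOn (fun u : ℝ => h (u + (1 - u) / S)⁻¹) (Icc 0 1) ∧
      ∫ u in (0 : ℝ)..1, h (u + (1 - u) / S)⁻¹ = g S := by
  intro h
  have hmaps : MapsTo (fun u : ℝ => (u + (1 - u) / S)⁻¹) (Icc 0 1) (Ici 1) :=
    fun u hu => (one_le_inv_convexComb hS hu).2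
  have hTc : ContinuousOn (fun u : ℝ => (u + (1 - u) / S)⁻¹) (Icc 0 1) := fun u hu =>
    (hasDerivAt_inv_convexComb (one_le_inv_convexComb hS hu).1.ne').continuousAt.continuousWithinAt
  have hhc : ContinuousOn h (Ici 1) :=
    ((continuousOn_id.mul (continuousOn_id.sub continuousOn_const)).mul
      (hg.continuousOn_derivWithin (uniqueDiffOn_Ici 1) le_rfl)).add hg.continuousOn
  have hc := hhc.comp hTc hmaps
  refine ⟨hc, ?_⟩
  have hderiv : ∀ u ∈ Ioo (0 : ℝ) 1,
      HasDerivAt (fun v : ℝ => -(1 - v) * g (v + (1 - v) / S)⁻¹)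
        (h (u + (1 - u) / S)⁻¹) u := by
    intro u hu
    have hu' := Ioo_subset_Icc_self hu
    have hne := (one_le_inv_convexComb hS hu').1.ne'
    have hgd := ((hg.differentiableOn one_ne_zero) _ (hmaps hu')).hasDerivWithinAt
    have hcomp := (hgd.comp u (hasDerivAt_inv_convexComb hne).hasDerivWithinAt hmaps).hasDerivAt
      (Icc_mem_nhds hu.1 hu.2)
    refine ((((hasDerivAt_id' u).const_sub 1).neg).mul hcomp).congr_deriv ?_
    simp only [h, Function.comp_apply, Pi.neg_apply]
    have hT : (u + (1 - u) / S)⁻¹ * ((u + (1 - u) / S)⁻¹ - 1)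
        = (1 - u) * (1 - 1 / S) / (u + (1 - u) / S) ^ 2 := by
      have h1 : 1 - (u + (1 - u) / S) = (1 - u) * (1 - 1 / S) := by ring
      rw [← h1]
      generalize u + (1 - u) / S = w at hne
      field_simp
    rw [hT]
    ring
  have hFc : ContinuousOn (fun v : ℝ => -(1 - v) * g (v + (1 - v) / S)⁻¹) (Icc 0 1) :=
    ContinuousOn.mul (by fun_prop) (hg.continuousOn.comp hTc hmaps)
  rw [intervalIntegral.integral_eq_sub_of_hasDerivAt_of_le zero_le_one hFc hderiv
    (hc.intervalIntegrable_of_Icc zero_le_one)]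
  simp

/-- The extended-nonnegative form of `integral_unif_inv_convexComb`. -/
lemma lintegral_unif_inv_convexComb {g : ℝ → ℝ} (hmono : MonotoneOn g (Ici 1))
    (hg : ContDiffOn ℝ 1 g (Ici 1)) (hnonneg : ∀ s ∈ Ici (1 : ℝ), 0 ≤ g s)
    {S : ℝ} (hS : 1 ≤ S) :
    ∫⁻ u, (Ici (1 : ℝ)).indicator
        (fun s => ENNReal.ofReal (s * (s - 1) * derivWithin g (Ici 1) s + g s))
        (u + (1 - u) / S)⁻¹ ∂unifMeasure = ENNReal.ofReal (g S) := by
  obtain ⟨hc, hint⟩ := integral_unif_inv_convexComb hg hS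
  have hnn : ∀ u ∈ Icc (0 : ℝ) 1, 0 ≤ (u + (1 - u) / S)⁻¹ * ((u + (1 - u) / S)⁻¹ - 1) *
      derivWithin g (Ici 1) (u + (1 - u) / S)⁻¹ + g (u + (1 - u) / S)⁻¹ := by
    intro u hu
    have hT := (one_le_inv_convexComb hS hu).2
    have hd : 0 ≤ derivWithin g (Ici 1) (u + (1 - u) / S)⁻¹ := hmono.derivWithin_nonneg
    exact add_nonneg (mul_nonneg (mul_nonneg (by linarith) (by linarith)) hd) (hnonneg _ hT)
  rw [unifMeasure, setLIntegral_congr_fun measurableSet_Icc fun u hu =>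
    indicator_of_mem (show _ ∈ Ici (1 : ℝ) from (one_le_inv_convexComb hS hu).2) _,
    ← ofReal_integral_eq_lintegral_ofReal (hc.integrableOn_compact isCompact_Icc)
      (ae_restrict_of_forall_mem measurableSet_Icc hnn),
    integral_Icc_eq_integral_Ioc, ← intervalIntegral.integral_of_le zero_le_one, hint]

/-- A sum of at least one coordinate is a.e. at least `1` for a product of measures on `[1,∞)`. -/
lemma ae_one_le_sum_pi {γ : Measure ℝ} [IsProbabilityMeasure γ] (hγ : γ (Iio 1) = 0)
    {k : ℕ} (hk : 1 ≤ k) :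
    ∀ᵐ x : Fin k → ℝ ∂(Measure.pi fun _ : Fin k => γ), 1 ≤ ∑ i, x i := by
  have h1 : ∀ᵐ s ∂γ, 1 ≤ s := by
    rw [ae_iff]
    simp only [not_le]
    exact hγ
  have hall : ∀ᵐ x : Fin k → ℝ ∂(Measure.pi fun _ : Fin k => γ), ∀ i, 1 ≤ x i :=
    ae_all_iff.2 fun i =>
      (measurePreserving_eval (fun _ : Fin k => γ) i).quasiMeasurePreserving.ae h1
  filter_upwards [hall] with x hx
  calc (1 : ℝ) ≤ k := by exact_mod_cast hk
    _ = ∑ _i : Fin k, (1 : ℝ) := by simp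
    _ ≤ ∑ i, x i := Finset.sum_le_sum fun i _ => hx i

/-- Integration of a nonnegative measurable function against `rdeMap`. -/
lemma lintegral_rdeMap (α : ℝ) (γ : Measure ℝ) [IsProbabilityMeasure γ] {H : ℝ → ENNReal}
    (hH : Measurable H) :
    ∫⁻ s, H s ∂(rdeMap α γ) = ∑' k : ℕ, ENNReal.ofReal (thetaDist α k) *
      ∫⁻ x : Fin k → ℝ, ∫⁻ u, H (u + (1 - u) / ∑ i, x i)⁻¹ ∂unifMeasure
        ∂(Measure.pi fun _ : Fin k => γ) := by
  have : SFinite unifMeasure := by unfold unifMeasure; infer_instance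
  rw [rdeMap, lintegral_sum_measure]
  refine tsum_congr fun k => ?_
  have hG : Measurable fun p : ℝ × (Fin k → ℝ) => (p.1 + (1 - p.1) / ∑ i, p.2 i)⁻¹ := by
    fun_prop
  rw [lintegral_smul_measure, lintegral_map hH hG, smul_eq_mul]
  exact congrArg _ (lintegral_prod_symm _ (hH.comp hG).aemeasurable)

/-- For a fixed point γ of the α-RDE and any nondecreasing C¹ function
g : [1,∞) → [0,∞), one has
∫ s(s−1)g′(s) γ(ds) + ∫ g(s) γ(ds) = Σ_k θ_α(k) ∫ g(s₁+⋯+s_k) γ^{⊗k}(ds),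
as an identity of extended nonnegative reals. -/
theorem rde_integral_identity (α : ℝ) (hα : α ∈ Set.Ioc (1 : ℝ) 2)
    (γ : Measure ℝ) (hγ : IsRDEFixedPoint α γ)
    (g : ℝ → ℝ) (hg_mono : MonotoneOn g (Set.Ici 1))
    (hg_smooth : ContDiffOn ℝ 1 g (Set.Ici 1))
    (hg_nonneg : ∀ s ∈ Set.Ici (1 : ℝ), 0 ≤ g s) :
    (∫⁻ s in Set.Ici 1, ENNReal.ofReal (s * (s - 1) * derivWithin g (Set.Ici 1) s) ∂γ)
      + (∫⁻ s in Set.Ici 1, ENNReal.ofReal (g s) ∂γ)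
    = ∑' k : ℕ, ENNReal.ofReal (thetaDist α k) *
        ∫⁻ s : Fin k → ℝ, ENNReal.ofReal (g (∑ i, s i))
          ∂(Measure.pi fun _ : Fin k => γ) := by
  obtain ⟨hprob, hsupp, hfix⟩ := hγ
  set H : ℝ → ENNReal := (Ici (1 : ℝ)).indicator
    (fun s => ENNReal.ofReal (s * (s - 1) * derivWithin g (Ici 1) s + g s)) with hHdef
  have hdc := hg_smooth.continuousOn_derivWithin (uniqueDiffOn_Ici 1) le_rfl
  have hc : ContinuousOn (fun s => s * (s - 1) * derivWithin g (Ici 1) s + g s) (Ici 1) :=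
    ((continuousOn_id.mul (continuousOn_id.sub continuousOn_const)).mul hdc).add
      hg_smooth.continuousOn
  have hH : Measurable H := by
    classical
    rw [hHdef, ← piecewise_eq_indicator]
    exact (ENNReal.continuous_ofReal.comp_continuousOn hc).measurable_piecewise
      continuousOn_const measurableSet_Ici
  have hgm : AEMeasurable (fun s => ENNReal.ofReal (g s)) (γ.restrict (Ici 1)) :=
    (ENNReal.continuous_ofReal.comp_continuousOn hg_smooth.continuousOn).aemeasurable
      measurableSet_Ici
  have hlhs : (∫⁻ s in Ici 1, ENNReal.ofReal (s * (s - 1) * derivWithin g (Ici 1) s) ∂γ)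
      + (∫⁻ s in Ici 1, ENNReal.ofReal (g s) ∂γ) = ∫⁻ s, H s ∂γ := by
    rw [← lintegral_add_right' _ hgm, hHdef, lintegral_indicator measurableSet_Ici]
    refine setLIntegral_congr_fun measurableSet_Ici fun s hs => ?_
    have hs' : (1 : ℝ) ≤ s := hs
    exact (ENNReal.ofReal_add (mul_nonneg (mul_nonneg (by linarith) (by linarith))
      hg_mono.derivWithin_nonneg) (hg_nonneg s hs)).symm
  rw [hlhs]
  conv_lhs => rw [← hfix]
  rw [lintegral_rdeMap α γ hH]
  refine tsum_congr fun k => ?_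
  by_cases hk : 2 ≤ k
  · congr 1
    refine lintegral_congr_ae ?_
    filter_upwards [ae_one_le_sum_pi hsupp (show 1 ≤ k by lia)] with x hx
    exact lintegral_unif_inv_convexComb hg_mono hg_smooth hg_nonneg hx
  · simp [thetaDist, hk]
end

section
/- Let σ be a probability measure on [1,∞) that is a fixed point of the 1-recursive distributional equation, i.e. σ is the law of (U + (1−U)/(X₁+⋯+X_N))^{−1} when U is uniform on [0,1], N is distributed according to θ_1, and (X_i)_{i≥1} are i.i.d. with law σ, all independent. Then the first moment of σ satisfies ∫ s σ(ds) ≤ 2·Σ_{k=2}^∞ (2 + k/(k−1)) · (log k)/(k(k−1)), and in particular it is finite. -/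
open MeasureTheory

/-- The offspring distribution θ_1: θ_1(k) = 1/(k(k−1)) for k ≥ 2, and 0 else. -/
noncomputable def theta1Dist (k : ℕ) : ℝ :=
  if 2 ≤ k then 1 / ((k : ℝ) * ((k : ℝ) - 1)) else 0

/-- The map on measures associated with the 1-recursive distributional equation:
the law of (U + (1−U)/(X₁+⋯+X_N))⁻¹ where U is uniform on [0,1], N ~ θ_1 and the
X_i are i.i.d. with law σ, all independent (decomposed according to the value of N). -/
noncomputable def rde1Map (σ : Measure ℝ) : Measure ℝ :=
  Measure.sum fun k : ℕ =>
    ENNReal.ofReal (theta1Dist k) •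
      Measure.map (fun p : ℝ × (Fin k → ℝ) => (p.1 + (1 - p.1) / ∑ i, p.2 i)⁻¹)
        (unifMeasure.prod (Measure.pi fun _ : Fin k => σ))

/-- σ is a probability measure on [1,∞) that is a fixed point of the 1-recursive
distributional equation. -/
def IsRDE1FixedPoint (σ : Measure ℝ) : Prop :=
  IsProbabilityMeasure σ ∧ σ (Set.Iio 1) = 0 ∧ rde1Map σ = σ

/-- Summability of the series appearing in the first moment bound. -/
lemma summable_first_moment_series : Summable fun k : ℕ =>
    (2 + ((k : ℝ) + 2) / ((k : ℝ) + 1)) * Real.log ((k : ℝ) + 2)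
      / (((k : ℝ) + 2) * ((k : ℝ) + 1)) := by
  have hs : Summable fun k : ℕ => 16 * (1 / ((k + 1 : ℕ) : ℝ) ^ (3 / 2 : ℝ)) :=
    (((Real.summable_one_div_nat_rpow (p := 3 / 2)).2 (by norm_num)).comp_injective
      (add_left_injective 1)).mul_left 16
  refine Summable.of_nonneg_of_le (fun k => ?_) (fun k => ?_) hs
  · have : 0 ≤ Real.log ((k : ℝ) + 2) := Real.log_nonneg (by linarith [k.cast_nonneg (α := ℝ)])
    positivity
  · have hk : (0 : ℝ) ≤ k := k.cast_nonneg
    push_cast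
    set x : ℝ := (k : ℝ) + 1 with hx
    have hx1 : 1 ≤ x := by linarith
    have hk2 : (k : ℝ) + 2 = x + 1 := by rw [hx]; ring
    rw [hk2]
    have hlog0 : 0 ≤ Real.log (x + 1) := Real.log_nonneg (by linarith)
    have hratio : (x + 1) / x ≤ 2 := by rw [div_le_iff₀ (by linarith)]; linarith
    have hsqrt : 1 ≤ Real.sqrt x := Real.one_le_sqrt.2 hx1
    have hsq : Real.sqrt x * Real.sqrt x = x := Real.mul_self_sqrt (by linarith)
    have hlog : Real.log (x + 1) ≤ 4 * Real.sqrt x := by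
      have h1 : x + 1 ≤ (2 * Real.sqrt x) ^ 2 := by nlinarith
      calc Real.log (x + 1) ≤ Real.log ((2 * Real.sqrt x) ^ 2) :=
            Real.log_le_log (by linarith) h1
        _ = 2 * Real.log (2 * Real.sqrt x) := by rw [Real.log_pow]; norm_num
        _ ≤ 2 * (2 * Real.sqrt x) := by
            gcongr; exact Real.log_le_self (by positivity)
        _ = 4 * Real.sqrt x := by ring
    have hpow : x ^ (3 / 2 : ℝ) = x * Real.sqrt x := by
      rw [Real.sqrt_eq_rpow, show (3 / 2 : ℝ) = 1 + 1 / 2 by norm_num,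
        Real.rpow_add (by linarith), Real.rpow_one]
    rw [hpow]
    calc (2 + (x + 1) / x) * Real.log (x + 1) / ((x + 1) * x)
        ≤ (2 + 2) * (4 * Real.sqrt x) / (x * x) := by
          gcongr; linarith
      _ = 16 * (1 / (x * Real.sqrt x)) := by
          have : 0 < Real.sqrt x := by linarith
          nth_rewrite 2 [← hsq]
          field_simp
          norm_num

/-- Truncating the value of the recursion at `M` is dominated by the sum of truncated arguments
and by the inverse of the first argument. -/
lemma min_recursion_le {k : ℕ} (hk : 1 ≤ k) {M u : ℝ} (hM : 0 ≤ M) (hu : u ∈ Set.Icc (0 : ℝ) 1)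
    {x : Fin k → ℝ} (hx : ∀ i, 1 ≤ x i) :
    min (u + (1 - u) / ∑ i, x i)⁻¹ M ≤ ∑ i, min (x i) M ∧
      (0 < u → min (u + (1 - u) / ∑ i, x i)⁻¹ M ≤ u⁻¹) := by
  obtain ⟨hu0, hu1⟩ := hu
  have hS : 1 ≤ ∑ i, x i :=
    calc (1 : ℝ) ≤ k := by exact_mod_cast hk
      _ = ∑ _i : Fin k, (1 : ℝ) := by simp
      _ ≤ ∑ i, x i := Finset.sum_le_sum fun i _ => hx i
  constructor
  · by_cases h : ∀ i, x i ≤ M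
    · have : ∑ i, min (x i) M = ∑ i, x i := Finset.sum_congr rfl fun i _ => min_eq_left (h i)
      rw [this]
      refine (min_le_left _ _).trans (inv_le_of_inv_le₀ (by linarith) ?_)
      have h1 : (∑ i, x i)⁻¹ ≤ 1 := inv_le_one_of_one_le₀ hS
      rw [div_eq_mul_inv]
      nlinarith
    · push Not at h
      obtain ⟨i, hi⟩ := h
      calc min _ M ≤ M := min_le_right _ _
        _ = min (x i) M := (min_eq_right hi.le).symm
        _ ≤ ∑ i, min (x i) M := Finset.single_le_sum (f := fun i => min (x i) M)
            (fun j _ => le_min (by linarith [hx j]) hM) (Finset.mem_univ i)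
  · intro hu
    refine (min_le_left _ _).trans (inv_anti₀ hu ?_)
    have : 0 ≤ (1 - u) / ∑ i, x i := div_nonneg (by linarith) (by linarith)
    linarith

lemma lintegral_inv_Ioc {a : ℝ} (ha : 0 < a) (ha1 : a ≤ 1) :
    ∫⁻ u in Set.Ioc a 1, ENNReal.ofReal u⁻¹ = ENNReal.ofReal (Real.log a⁻¹) := by
  have hint : IntervalIntegrable (fun u : ℝ => u⁻¹) volume a 1 := by
    refine intervalIntegral.intervalIntegrable_inv (fun u hu => ?_) continuousOn_id
    rw [Set.uIcc_of_le ha1] at hu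
    exact (ha.trans_le hu.1).ne'
  rw [← ofReal_integral_eq_lintegral_ofReal, ← intervalIntegral.integral_of_le ha1,
    integral_inv_of_pos ha one_pos, one_div]
  · exact (intervalIntegrable_iff_integrableOn_Ioc_of_le ha1).1 hint
  · filter_upwards [ae_restrict_mem measurableSet_Ioc] with u hu
    exact inv_nonneg.2 (ha.trans hu.1).le

instance : IsProbabilityMeasure unifMeasure := ⟨by simp [unifMeasure]⟩

lemma measurable_recursion (k : ℕ) :
    Measurable fun p : ℝ × (Fin k → ℝ) => (p.1 + (1 - p.1) / ∑ i, p.2 i)⁻¹ := by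
  fun_prop

lemma lintegral_min_recursion_le (σ : Measure ℝ) [IsProbabilityMeasure σ]
    (hσ : σ (Set.Iio 1) = 0) {k : ℕ} (hk : 1 ≤ k) {M : ℝ} (hM : 0 ≤ M) :
    ∫⁻ p, ENNReal.ofReal (min (p.1 + (1 - p.1) / ∑ i, p.2 i)⁻¹ M)
        ∂(unifMeasure.prod (Measure.pi fun _ : Fin k => σ))
      ≤ ENNReal.ofReal (Real.log (2 * k)) + (∫⁻ s, ENNReal.ofReal (min s M) ∂σ) / 2 := by
  set m := ∫⁻ s, ENNReal.ofReal (min s M) ∂σ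
  set a : ℝ := (2 * (k : ℝ))⁻¹ with ha
  have hk' : (1 : ℝ) ≤ k := by exact_mod_cast hk
  have ha0 : 0 < a := by positivity
  have ha1 : a ≤ 1 := inv_le_one_of_one_le₀ (by linarith)
  let f₁ : ℝ → ENNReal := (Set.Iic a).indicator 1
  let f₂ : ℝ → ENNReal := (Set.Ioi a).indicator fun u => ENNReal.ofReal u⁻¹
  let g : (Fin k → ℝ) → ENNReal := fun x => ∑ i, ENNReal.ofReal (min (x i) M)
  have hf₁ : Measurable f₁ := measurable_one.indicator measurableSet_Iic
  have hf₂ : Measurable f₂ := Measurable.indicator (by fun_prop) measurableSet_Ioi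
  have hg : Measurable g := by fun_prop
  have hx : ∀ᵐ x ∂(Measure.pi fun _ : Fin k => σ), ∀ i, 1 ≤ x i := by
    rw [ae_all_iff]
    intro i
    refine (measurePreserving_eval (fun _ : Fin k => σ) i).quasiMeasurePreserving.ae
      (p := fun y => 1 ≤ y) ?_
    rw [ae_iff]
    simpa [Set.Iio] using hσ
  have hu : ∀ᵐ u ∂unifMeasure, u ∈ Set.Icc (0 : ℝ) 1 := ae_restrict_mem measurableSet_Icc
  have hle : ∀ᵐ p ∂(unifMeasure.prod (Measure.pi fun _ : Fin k => σ)),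
      ENNReal.ofReal (min (p.1 + (1 - p.1) / ∑ i, p.2 i)⁻¹ M) ≤ f₁ p.1 * g p.2 + f₂ p.1 * 1 := by
    filter_upwards [Measure.quasiMeasurePreserving_fst.ae hu,
      Measure.quasiMeasurePreserving_snd.ae hx] with p hp1 hp2
    obtain ⟨h1, h2⟩ := min_recursion_le hk hM hp1 hp2
    by_cases hpa : p.1 ≤ a
    · have hsum : g p.2 = ENNReal.ofReal (∑ i, min (p.2 i) M) :=
        (ENNReal.ofReal_sum_of_nonneg fun i _ => le_min (by linarith [hp2 i]) hM).symm
      simpa [f₁, f₂, hpa, hsum] using ENNReal.ofReal_le_ofReal h1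
    · have hpa' : a < p.1 := not_le.1 hpa
      simpa [f₁, f₂, hpa, hpa'] using ENNReal.ofReal_le_ofReal (h2 (ha0.trans hpa'))
  have hF₁ : ∫⁻ u, f₁ u ∂unifMeasure = ENNReal.ofReal a := by
    have hset : Set.Iic a ∩ Set.Icc (0 : ℝ) 1 = Set.Icc 0 a := by
      ext u
      simp only [Set.mem_inter_iff, Set.mem_Iic, Set.mem_Icc]
      constructor
      · rintro ⟨h, h', -⟩; exact ⟨h', h⟩
      · rintro ⟨h, h'⟩; exact ⟨h', h, h'.trans ha1⟩
    rw [lintegral_indicator_one measurableSet_Iic, unifMeasure,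
      Measure.restrict_apply measurableSet_Iic, hset, Real.volume_Icc, sub_zero]
  have hF₂ : ∫⁻ u, f₂ u ∂unifMeasure = ENNReal.ofReal (Real.log (2 * k)) := by
    have hset : Set.Ioi a ∩ Set.Icc (0 : ℝ) 1 = Set.Ioc a 1 := by
      ext u
      simp only [Set.mem_inter_iff, Set.mem_Ioi, Set.mem_Icc, Set.mem_Ioc]
      constructor
      · rintro ⟨h, -, h'⟩; exact ⟨h, h'⟩
      · rintro ⟨h, h'⟩; exact ⟨h, (ha0.trans h).le, h'⟩
    rw [lintegral_indicator measurableSet_Ioi, unifMeasure,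
      Measure.restrict_restrict measurableSet_Ioi, hset, lintegral_inv_Ioc ha0 ha1, ha, inv_inv]
  have hG : ∫⁻ x, g x ∂(Measure.pi fun _ : Fin k => σ) = k * m := by
    rw [lintegral_finsetSum _ fun i _ => by fun_prop]
    have (i : Fin k) : ∫⁻ x, ENNReal.ofReal (min (x i) M) ∂(Measure.pi fun _ : Fin k => σ) = m :=
      (measurePreserving_eval (fun _ : Fin k => σ) i).lintegral_comp
        (f := fun y => ENNReal.ofReal (min y M)) (by fun_prop)
    simp only [this, Finset.sum_const, Finset.card_univ, Fintype.card_fin, nsmul_eq_mul]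
  have hak : ENNReal.ofReal a * (k * m) = m / 2 := by
    have : ENNReal.ofReal a * k = 2⁻¹ := by
      rw [← ENNReal.ofReal_natCast k, ← ENNReal.ofReal_mul ha0.le,
        show a * k = 2⁻¹ by rw [ha]; field_simp, ENNReal.ofReal_inv_of_pos two_pos]
      norm_num
    rw [← mul_assoc, this, mul_comm, ENNReal.div_eq_inv_mul, mul_comm]
  calc _ ≤ ∫⁻ p, f₁ p.1 * g p.2 + f₂ p.1 * 1 ∂(unifMeasure.prod (Measure.pi fun _ => σ)) :=
        lintegral_mono_ae hle
    _ = (∫⁻ u, f₁ u ∂unifMeasure) * (∫⁻ x, g x ∂(Measure.pi fun _ => σ))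
        + (∫⁻ u, f₂ u ∂unifMeasure) * ∫⁻ _, 1 ∂(Measure.pi fun _ : Fin k => σ) := by
        rw [lintegral_add_left (by fun_prop), lintegral_prod_mul hf₁.aemeasurable hg.aemeasurable,
          lintegral_prod_mul hf₂.aemeasurable (g := fun _ => 1) aemeasurable_const]
    _ = _ := by
        rw [hF₁, hF₂, hG, hak, add_comm]
        simp

lemma lintegral_rde1Map (σ : Measure ℝ) {f : ℝ → ENNReal} (hf : Measurable f) :
    ∫⁻ s, f s ∂(rde1Map σ) = ∑' k : ℕ, ENNReal.ofReal (theta1Dist k) *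
      ∫⁻ p, f (p.1 + (1 - p.1) / ∑ i, p.2 i)⁻¹
        ∂(unifMeasure.prod (Measure.pi fun _ : Fin k => σ)) := by
  simp only [rde1Map, lintegral_sum_measure, lintegral_smul_measure, smul_eq_mul,
    lintegral_map hf (measurable_recursion _)]

/-- The truncated first moments of a fixed point are bounded uniformly in the truncation. -/
lemma lintegral_min_le {σ : Measure ℝ} (hσ : IsRDE1FixedPoint σ) {M : ℝ} (hM : 0 ≤ M) :
    ∫⁻ s, ENNReal.ofReal (min s M) ∂σ ≤
      2 * ∑' k : ℕ, ENNReal.ofReal (theta1Dist k) * ENNReal.ofReal (Real.log (2 * k)) := by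
  obtain ⟨hprob, hsupp, hfix⟩ := hσ
  have hmass : ∑' k : ℕ, ENNReal.ofReal (theta1Dist k) = 1 := by
    have h := lintegral_rde1Map σ (f := fun _ => 1) measurable_const
    rw [hfix] at h
    simpa using h.symm
  set m := ∫⁻ s, ENNReal.ofReal (min s M) ∂σ with hm
  have hmtop : m ≠ ⊤ := by
    refine ne_top_of_le_ne_top (ENNReal.ofReal_ne_top (r := M)) ?_
    calc m ≤ ∫⁻ _, ENNReal.ofReal M ∂σ :=
          lintegral_mono fun s => ENNReal.ofReal_le_ofReal (min_le_right s M)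
      _ = ENNReal.ofReal M := by simp
  set L := ∑' k : ℕ, ENNReal.ofReal (theta1Dist k) * ENNReal.ofReal (Real.log (2 * k))
  have key : m ≤ L + m / 2 :=
    calc m = ∑' k : ℕ, ENNReal.ofReal (theta1Dist k) *
          ∫⁻ p, ENNReal.ofReal (min (p.1 + (1 - p.1) / ∑ i, p.2 i)⁻¹ M)
            ∂(unifMeasure.prod (Measure.pi fun _ : Fin k => σ)) := by
          rw [← lintegral_rde1Map σ (f := fun s => ENNReal.ofReal (min s M)) (by fun_prop), hfix]
      _ ≤ ∑' k : ℕ, ENNReal.ofReal (theta1Dist k) *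
          (ENNReal.ofReal (Real.log (2 * k)) + m / 2) := by
          refine ENNReal.tsum_le_tsum fun k => ?_
          by_cases hk : 2 ≤ k
          · gcongr
            exact lintegral_min_recursion_le σ hsupp (by lia) hM
          · simp [theta1Dist, hk]
      _ = L + m / 2 := by
          simp only [mul_add, ENNReal.tsum_add, ENNReal.tsum_mul_right, hmass, one_mul, L]
  have hhalf : m / 2 ≤ L := by
    have hne : m / 2 ≠ ⊤ := (ENNReal.div_lt_top hmtop two_ne_zero).ne
    nth_rewrite 1 [← ENNReal.add_halves m] at key
    exact (ENNReal.add_le_add_iff_right hne).1 key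
  calc m = 2 * (m / 2) := (ENNReal.mul_div_cancel two_ne_zero ENNReal.ofNat_ne_top).symm
    _ ≤ 2 * L := by gcongr

lemma theta1_log_series_le :
    ∑' k : ℕ, ENNReal.ofReal (theta1Dist k) * ENNReal.ofReal (Real.log (2 * k)) ≤
      ENNReal.ofReal (∑' k : ℕ, (2 + ((k : ℝ) + 2) / ((k : ℝ) + 1)) * Real.log ((k : ℝ) + 2)
        / (((k : ℝ) + 2) * ((k : ℝ) + 1))) := by
  have hlog (k : ℕ) : 0 ≤ Real.log ((k : ℝ) + 2) :=
    Real.log_nonneg (by linarith [k.cast_nonneg (α := ℝ)])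
  have hnonneg (k : ℕ) : 0 ≤ (2 + ((k : ℝ) + 2) / ((k : ℝ) + 1)) * Real.log ((k : ℝ) + 2)
      / (((k : ℝ) + 2) * ((k : ℝ) + 1)) :=
    div_nonneg (mul_nonneg (by positivity) (hlog k)) (by positivity)
  rw [ENNReal.ofReal_tsum_of_nonneg hnonneg summable_first_moment_series,
    ← ENNReal.summable.sum_add_tsum_nat_add' (k := 2)]
  have hzero : ∑ i ∈ Finset.range 2,
      ENNReal.ofReal (theta1Dist i) * ENNReal.ofReal (Real.log (2 * i)) = 0 := by
    simp [Finset.sum_range_succ, theta1Dist]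
  rw [hzero, zero_add]
  refine ENNReal.tsum_le_tsum fun k => ?_
  have hk : (0 : ℝ) ≤ k := k.cast_nonneg
  have htheta : theta1Dist (k + 2) = 1 / (((k : ℝ) + 2) * ((k : ℝ) + 1)) := by
    simp only [theta1Dist, le_add_iff_nonneg_left, zero_le, if_true]
    push_cast
    ring_nf
  rw [htheta, ← ENNReal.ofReal_mul (by positivity), one_div_mul_eq_div]
  refine ENNReal.ofReal_le_ofReal ?_
  gcongr
  push_cast
  rw [Real.log_mul two_ne_zero (by positivity)]
  have h2 : Real.log 2 ≤ Real.log ((k : ℝ) + 2) := Real.log_le_log two_pos (by linarith)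
  have hnn : 0 ≤ ((k : ℝ) + 2) / ((k : ℝ) + 1) * Real.log ((k : ℝ) + 2) :=
    mul_nonneg (by positivity) (hlog k)
  linarith

/-- Any fixed point σ of the 1-RDE has first moment bounded by
2·Σ_{k=2}^∞ (2 + k/(k−1))·(log k)/(k(k−1)); in particular it is finite.
(The series is indexed below by k ↦ k+2.) -/
theorem first_moment_bound_theta1 (σ : Measure ℝ) (hσ : IsRDE1FixedPoint σ) :
    (∫⁻ s, ENNReal.ofReal s ∂σ)
      ≤ ENNReal.ofReal (2 * ∑' k : ℕ,
          (2 + ((k : ℝ) + 2) / ((k : ℝ) + 1)) * Real.log ((k : ℝ) + 2)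
            / (((k : ℝ) + 2) * ((k : ℝ) + 1))) ∧
    (∫⁻ s, ENNReal.ofReal s ∂σ) < ⊤ := by
  have hle : (∫⁻ s, ENNReal.ofReal s ∂σ)
      ≤ ENNReal.ofReal (2 * ∑' k : ℕ,
          (2 + ((k : ℝ) + 2) / ((k : ℝ) + 1)) * Real.log ((k : ℝ) + 2)
            / (((k : ℝ) + 2) * ((k : ℝ) + 1))) := by
    rw [ENNReal.ofReal_mul two_pos.le, ENNReal.ofReal_ofNat]
    calc ∫⁻ s, ENNReal.ofReal s ∂σ
        ≤ ∫⁻ s, ⨆ n : ℕ, ENNReal.ofReal (min s n) ∂σ := by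
          refine lintegral_mono fun s => ?_
          obtain ⟨n, hn⟩ := exists_nat_ge s
          exact le_iSup_of_le n (by rw [min_eq_left hn])
      _ = ⨆ n : ℕ, ∫⁻ s, ENNReal.ofReal (min s n) ∂σ :=
          lintegral_iSup (fun n => by fun_prop) fun i j hij s =>
            ENNReal.ofReal_le_ofReal (min_le_min_left s (by exact_mod_cast hij))
      _ ≤ 2 * ∑' k : ℕ, ENNReal.ofReal (theta1Dist k) * ENNReal.ofReal (Real.log (2 * k)) :=
          iSup_le fun n => lintegral_min_le hσ n.cast_nonneg
      _ ≤ _ := by gcongr; exact theta1_log_series_le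
  exact ⟨hle, hle.trans_lt ENNReal.ofReal_lt_top⟩
end
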